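/- Let L and s be positive integers with L ≥ 3, and let V = {k_1, k_2, ..., k_t} ⊆ {s+1, ..., L+s} with k_1 > k_2 > ... > k_t and t = |V| ≥ 1. Suppose t! · k_t ≥ (2^{t+4}·s + s^2) · t^t. Define F(s) = (10s-2)(15s-3) + 8s and κ(s) = (12s-1)·( (s+1) + (s+2) + ... + (F(s)-1) ) + 1. Then for every integer N ≥ κ(s), the number of partitions of N lying in I_{L,s,V} is at least the number of partitions of N lying in D_{L,s,V}. -/

import Mathlib

/-- Every integer exceeding `s` is a sum of integers in `[s + 1, 2 * s + 1]`. -/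
lemma exists_multiset_sum_eq_of_lt (s d : ℕ) (h : s < d) :
    ∃ g : Multiset ℕ, (∀ x ∈ g, s + 1 ≤ x ∧ x ≤ 2 * s + 1) ∧ g.sum = d := by
  induction d using Nat.strong_induction_on with
  | _ d ih =>
    by_cases hd : d ≤ 2 * s + 1
    · exact ⟨{d}, by simp; omega, by simp⟩
    · obtain ⟨g, hg, hsum⟩ := ih (d - (s + 1)) (by omega) (by omega)
      refine ⟨(s + 1) ::ₘ g, ?_, ?_⟩
      · intro x hx
        rcases Multiset.mem_cons.1 hx with rfl | hx
        · omega
        · exact hg x hx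
      · rw [Multiset.sum_cons, hsum]; omega

/-- Division with remainder of multiplicities by `n`, for the elements below `F`. -/
lemma Multiset.add_nsmul_inj_of_count_lt {n F : ℕ} {μ μ' δ δ' : Multiset ℕ}
    (hμ : ∀ i < F, μ.count i < n) (hμ' : ∀ i < F, μ'.count i < n)
    (hδ : ∀ x ∈ δ, x < F) (hδ' : ∀ x ∈ δ', x < F)
    (h : μ + n • δ = μ' + n • δ') : μ = μ' ∧ δ = δ' := by
  have hδδ' : δ = δ' := by
    ext i
    by_cases hi : i < F
    · have hc := congrArg (fun x => Multiset.count i x / n) h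
      have h1 := hμ i hi
      simp only [Multiset.count_add, Multiset.count_nsmul] at hc
      rwa [Nat.add_mul_div_left _ _ (by omega), Nat.add_mul_div_left _ _ (by omega),
        Nat.div_eq_of_lt h1, Nat.div_eq_of_lt (hμ' i hi), zero_add, zero_add] at hc
    · rw [Multiset.count_eq_zero_of_notMem fun hx => hi (hδ i hx),
        Multiset.count_eq_zero_of_notMem fun hx => hi (hδ' i hx)]
  subst hδδ'
  exact ⟨add_right_cancel h, rfl⟩

lemma Multiset.count_mul_le_sum (x : Multiset ℕ) (k : ℕ) : x.count k * k ≤ x.sum := by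
  have h := Multiset.le_count_iff_replicate_le.1 (le_refl (x.count k))
  obtain ⟨y, hy⟩ := Multiset.le_iff_exists_add.1 h
  have h2 := congrArg Multiset.sum hy
  rw [Multiset.sum_add, Multiset.sum_replicate, smul_eq_mul] at h2
  omega

/-- A finite set of nonempty multisets on `V` whose multiplicities are `t`-th powers has at most
`2 ^ t * B ^ t` elements, where `B ^ t` is the largest multiplicity occurring. -/
lemma exists_card_le_two_pow_mul_pow (V : Finset ℕ) (hV : V.Nonempty)
    (S : Finset {x : Multiset ℕ // x ≠ 0 ∧ (∀ k ∈ x, k ∈ V) ∧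
      ∀ k ∈ V, ∃ m : ℕ, x.count k = m ^ V.card}) (hS : S.Nonempty) :
    ∃ x ∈ S, ∃ k ∈ V, ∃ B : ℕ, 1 ≤ B ∧ x.1.count k = B ^ V.card ∧
      S.card ≤ 2 ^ V.card * B ^ V.card := by
  choose m hm using fun x : {x : Multiset ℕ // x ≠ 0 ∧ (∀ k ∈ x, k ∈ V) ∧
      ∀ k ∈ V, ∃ m : ℕ, x.count k = m ^ V.card} => fun k : V => x.2.2.2 k.1 k.2
  have hVu : (Finset.univ : Finset V).Nonempty := by
    obtain ⟨k, hk⟩ := hV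
    exact ⟨⟨k, hk⟩, Finset.mem_univ _⟩
  obtain ⟨⟨x, k⟩, hxk, hmax⟩ := Finset.exists_max_image (S ×ˢ (Finset.univ : Finset V))
    (fun z => m z.1 z.2) (hS.product hVu)
  have hxS : x ∈ S := (Finset.mem_product.1 hxk).1
  have hle : ∀ y ∈ S, ∀ j : V, m y j ≤ m x k := fun y hy j =>
    hmax (y, j) (Finset.mem_product.2 ⟨hy, Finset.mem_univ _⟩)
  have ht : V.card ≠ 0 := Finset.card_ne_zero.2 hV
  have hB : 1 ≤ m x k := by
    obtain ⟨j, hj⟩ := Multiset.exists_mem_of_ne_zero x.2.1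
    have hjV := x.2.2.1 j hj
    refine le_trans ?_ (hle x hxS ⟨j, hjV⟩)
    by_contra hlt
    have h0 : m x ⟨j, hjV⟩ = 0 := by omega
    have hc := hm x ⟨j, hjV⟩
    rw [h0, zero_pow ht] at hc
    exact Multiset.count_ne_zero.2 hj hc
  refine ⟨x, hxS, k.1, k.2, m x k, hB, hm x k, ?_⟩
  have hcard : S.card ≤ (Fintype.piFinset fun _ : V => Finset.range (m x k + 1)).card := by
    refine Finset.card_le_card_of_injOn m ?_ ?_
    · intro y hy
      simp only [Finset.mem_coe, Fintype.mem_piFinset, Finset.mem_range]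
      exact fun j => Nat.lt_succ_of_le (hle y hy j)
    · intro y _ z _ hyz
      apply Subtype.ext
      ext j
      by_cases hj : j ∈ V
      · rw [hm y ⟨j, hj⟩, hm z ⟨j, hj⟩, hyz]
      · rw [Multiset.count_eq_zero_of_notMem fun h => hj (y.2.2.1 j h),
          Multiset.count_eq_zero_of_notMem fun h => hj (z.2.2.1 j h)]
  rw [Fintype.card_piFinset, Finset.prod_const, Finset.card_range, Finset.card_univ,
    Fintype.card_coe] at hcard
  rw [← mul_pow]
  exact hcard.trans (Nat.pow_le_pow_left (by omega) _)

/-- Nonempty multisets on `V` with `t`-th power multiplicities can be labelled injectively by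
integers congruent to one of `13, …, 23` modulo `24` that are small relative to their sums. -/
lemma exists_injective_label (V : Finset ℕ) (hV : V.Nonempty) (s : ℕ) (hs : 0 < s)
    (hk : ∀ k ∈ V, 2 ^ (V.card + 4) * s ≤ k) :
    ∃ f : {x : Multiset ℕ // x ≠ 0 ∧ (∀ k ∈ x, k ∈ V) ∧
        ∀ k ∈ V, ∃ m : ℕ, x.count k = m ^ V.card} → ℕ,
      Function.Injective f ∧ ∀ x, 13 ≤ f x % 24 ∧ f x * s + (s + 1) ≤ x.1.sum := by
  let T : {x : Multiset ℕ // x ≠ 0 ∧ (∀ k ∈ x, k ∈ V) ∧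
      ∀ k ∈ V, ∃ m : ℕ, x.count k = m ^ V.card} → Finset ℕ := fun x =>
    (Finset.range (x.1.sum + 1)).filter fun a => 13 ≤ a % 24 ∧ a * s + (s + 1) ≤ x.1.sum
  obtain ⟨f, hf, hfT⟩ := (Finset.all_card_le_biUnion_card_iff_exists_injective T).1 (by
    intro S
    rcases S.eq_empty_or_nonempty with rfl | hS
    · simp
    obtain ⟨x, hxS, k, hkV, B, hB, hc, hcard⟩ := exists_card_le_two_pow_mul_pow V hV S hS
    have hsub : T x ⊆ S.biUnion T := Finset.subset_biUnion_of_mem T hxS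
    refine (hcard.trans ?_).trans (Finset.card_le_card hsub)
    have hsum := x.1.count_mul_le_sum k
    rw [hc] at hsum
    have hY : 2 ≤ 2 ^ V.card * B ^ V.card := by
      have h2 : 2 ^ 1 ≤ 2 ^ V.card := Nat.pow_le_pow_right (by norm_num) (Finset.card_pos.2 hV)
      have h3 : 0 < B ^ V.card := Nat.pow_pos hB
      nlinarith
    have hbig : 16 * (2 ^ V.card * B ^ V.card) * s ≤ x.1.sum := by
      calc 16 * (2 ^ V.card * B ^ V.card) * s = B ^ V.card * (2 ^ (V.card + 4) * s) := by ring
        _ ≤ B ^ V.card * k := Nat.mul_le_mul_left _ (hk k hkV)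
        _ ≤ _ := hsum
    generalize 2 ^ V.card * B ^ V.card = Y at hY hbig ⊢
    rw [← Finset.card_range Y]
    refine Finset.card_le_card_of_injOn (fun j => 24 * (j / 11) + 13 + j % 11) ?_ ?_
    · intro j hj
      have hj : j < Y := by simpa using hj
      have ha : 24 * (j / 11) + 13 + j % 11 + 2 ≤ 16 * Y := by omega
      have h1 : (24 * (j / 11) + 13 + j % 11) * s + (s + 1) ≤ x.1.sum := by nlinarith
      have h2 : 24 * (j / 11) + 13 + j % 11 < x.1.sum + 1 := by nlinarith
      simp only [T, Finset.mem_coe, Finset.mem_filter, Finset.mem_range]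
      exact ⟨h2, by omega, h1⟩
    · intro i _ j _ hij
      simp only at hij
      omega)
  exact ⟨f, hf, fun x => (Finset.mem_filter.1 (hfT x)).2⟩

/-- A multiset of integers in `[s + 1, F - 1]` with all multiplicities at most `c` has sum at most
`c * ((s + 1) + ⋯ + (F - 1))`. -/
lemma Multiset.sum_le_mul_sum_Icc {s F c : ℕ} {μ : Multiset ℕ}
    (hμ : ∀ x ∈ μ, s + 1 ≤ x ∧ x < F) (hc : ∀ x ∈ μ, μ.count x ≤ c) :
    μ.sum ≤ c * ∑ i ∈ Finset.Icc (s + 1) (F - 1), i := by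
  rw [Finset.sum_multiset_count_of_subset μ (Finset.Icc (s + 1) (F - 1)), Finset.mul_sum]
  · refine Finset.sum_le_sum fun i _ => ?_
    rw [smul_eq_mul]
    refine Nat.mul_le_mul_right _ ?_
    by_cases hi : i ∈ μ
    · exact hc i hi
    · simp [Multiset.count_eq_zero_of_notMem hi]
  · intro i hi
    have := hμ i (Multiset.mem_toFinset.1 hi)
    rw [Finset.mem_Icc]
    omega

/-- Decomposition of a large part `p` as `s + r + s * (a + 12 * d)`, where `a` determines `r`. -/
lemma exists_large_part_decomposition {s p : ℕ} (hs : 0 < s)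
    (hp : (10 * s - 2) * (15 * s - 3) + 8 * s ≤ p) :
    ∃ r a d : ℕ, 1 ≤ r ∧ r ≤ s ∧
      (a = 12 * r ∨ ∃ j, 1 ≤ j ∧ j ≤ 11 ∧ a = 24 * (r - 1) + j) ∧ s < d ∧
      p = s + r + s * (a + 12 * d) := by
  obtain ⟨s, rfl⟩ : ∃ u, s = u + 1 := ⟨s - 1, by omega⟩
  have hp' : (10 * s + 8) * (15 * s + 12) + 8 * (s + 1) ≤ p := by
    have h1 : 10 * (s + 1) - 2 = 10 * s + 8 := by omega
    have h2 : 15 * (s + 1) - 3 = 15 * s + 12 := by omega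
    rwa [h1, h2] at hp
  have hdiv := Nat.div_add_mod (p - 1) (s + 1)
  have hmod := Nat.mod_lt (p - 1) (Nat.succ_pos s)
  generalize (p - 1) / (s + 1) = Q at hdiv
  generalize (p - 1) % (s + 1) = R at hdiv hmod
  have hpQ : p = (s + 1) * Q + (R + 1) := by
    have : 1 ≤ p := by nlinarith
    omega
  have hQ : 36 * (s + 1) + 14 ≤ Q := by
    by_contra hlt
    have : (s + 1) * Q ≤ (s + 1) * (36 * (s + 1) + 13) := Nat.mul_le_mul_left _ (by omega)
    nlinarith
  have key : ∀ a, a ≤ 24 * (s + 1) → (Q - 1) % 12 = a % 12 →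
      s + 1 < (Q - 1 - a) / 12 ∧
        p = s + 1 + (R + 1) + (s + 1) * (a + 12 * ((Q - 1 - a) / 12)) := by
    intro a ha hmod
    have h : Q = 1 + (a + 12 * ((Q - 1 - a) / 12)) := by omega
    refine ⟨by omega, ?_⟩
    rw [hpQ]
    conv_lhs => rw [h]
    ring
  by_cases h0 : (Q - 1) % 12 = 0
  · obtain ⟨h1, h2⟩ := key (12 * (R + 1)) (by omega) (by omega)
    exact ⟨R + 1, _, _, by omega, by omega, Or.inl rfl, h1, h2⟩
  · obtain ⟨h1, h2⟩ := key (24 * R + (Q - 1) % 12) (by omega) (by omega)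
    exact ⟨R + 1, _, _, by omega, by omega, Or.inr ⟨(Q - 1) % 12, by omega, by omega, by simp⟩,
      h1, h2⟩

/-- `PartReplacement s F f g l a ν` says that the multiset `l` is replaced by `a` copies of `s`
together with `ν`: a subfamily `x` of forbidden parts is traded for `f x` copies of `s` and the
parts `g (x.sum - f x * s)`, a part `i` of multiplicity at least `12 * s` for `12 * i` copies of
`s`, or a large part for copies of `s`, one part `s + r` and a multiset repeated `12 * s` times. -/
inductive PartReplacement (s F : ℕ) {P : Multiset ℕ → Prop} (f : Subtype P → ℕ)
    (g : ℕ → Multiset ℕ) : Multiset ℕ → ℕ → Multiset ℕ → Prop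
  | forbiddenPart (x : Subtype P) (μ : Multiset ℕ) :
      PartReplacement s F f g (x.1 + μ) (f x) (μ + g (x.1.sum - f x * s))
  | frequentPart (i : ℕ) (μ : Multiset ℕ) (hi : s < i) :
      PartReplacement s F f g (μ + Multiset.replicate (12 * s) i) (12 * i) μ
  | largePart (r a : ℕ) (μ δ : Multiset ℕ) (hr : 1 ≤ r) (hrs : r ≤ s)
      (ha : a = 12 * r ∨ ∃ j, 1 ≤ j ∧ j ≤ 11 ∧ a = 24 * (r - 1) + j)
      (hδ : ∀ x ∈ δ, x < F) (hμ : ∀ i < F, μ.count i < 12 * s) :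
      PartReplacement s F f g (μ + {s + r + s * (a + 12 * δ.sum)}) a
        (μ + (12 * s) • δ + {s + r})

lemma PartReplacement.left_unique {s F : ℕ} {P : Multiset ℕ → Prop} {f : Subtype P → ℕ}
    {g : ℕ → Multiset ℕ} (hf : Function.Injective f) (hf24 : ∀ x, 13 ≤ f x % 24)
    {l l' : Multiset ℕ} {a : ℕ} {ν : Multiset ℕ} (h : PartReplacement s F f g l a ν)
    (h' : PartReplacement s F f g l' a ν) : l = l' := by
  generalize hb : a = b at h'
  generalize hξ : ν = ξ at h'
  cases h with
  | forbiddenPart x μ =>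
    have hx := hf24 x
    cases h' with
    | forbiddenPart y μ' =>
      obtain rfl := hf hb
      rw [add_right_cancel hξ]
    | frequentPart i μ' hi => omega
    | largePart r a μ' δ hr hrs ha hδ hμ =>
      rcases ha with ha | ⟨j, hj, hj', ha⟩ <;> omega
  | frequentPart i μ hi =>
    cases h' with
    | forbiddenPart y μ' =>
      have hy := hf24 y
      omega
    | frequentPart i' μ' hi' =>
      obtain rfl : i = i' := by omega
      rw [hξ]
    | largePart r a μ' δ hr hrs ha hδ hμ =>
      rcases ha with ha | ⟨j, hj, hj', ha⟩ <;> omega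
  | largePart r a μ δ hr hrs ha hδ hμ =>
    cases h' with
    | forbiddenPart y μ' =>
      have hy := hf24 y
      rcases ha with ha | ⟨j, hj, hj', ha⟩ <;> omega
    | frequentPart i' μ' hi' =>
      rcases ha with ha | ⟨j, hj, hj', ha⟩ <;> omega
    | largePart r' a' μ' δ' hr' hrs' ha' hδ' hμ' =>
      obtain rfl : r = r' := by
        rcases ha with ha | ⟨j, hj, hj2, ha⟩ <;> rcases ha' with ha' | ⟨j', hj', hj2', ha'⟩ <;> omega
      obtain ⟨rfl, rfl⟩ := Multiset.add_nsmul_inj_of_count_lt hμ hμ' hδ hδ' (add_right_cancel hξ)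
      rw [hb]

/-- Every partition of a large `N` admits a replacement. -/
lemma exists_partReplacement {L s F N : ℕ} (hs : 0 < s) {V : Finset ℕ}
    (hV : ∀ k ∈ V, 2 * s + 1 < k ∧ k ≤ L + s) (hVne : V.Nonempty)
    (hF : F = (10 * s - 2) * (15 * s - 3) + 8 * s)
    (hN : (12 * s - 1) * (∑ i ∈ Finset.Icc (s + 1) (F - 1), i) + 1 ≤ N)
    (f : {x : Multiset ℕ // x ≠ 0 ∧ (∀ k ∈ x, k ∈ V) ∧
        ∀ k ∈ V, ∃ m : ℕ, x.count k = m ^ V.card} → ℕ)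
    (hf : ∀ x, 13 ≤ f x % 24 ∧ f x * s + (s + 1) ≤ x.1.sum)
    (g : ℕ → Multiset ℕ)
    (hg : ∀ d, s < d → (∀ x ∈ g d, s + 1 ≤ x ∧ x ≤ 2 * s + 1) ∧ (g d).sum = d)
    (l : Multiset ℕ) (hsum : l.sum = N) (hl : ∀ x ∈ l, s + 1 ≤ x ∧ x ≤ L + s)
    (hlV : ∀ k ∈ V, ∃ m : ℕ, l.count k = m ^ V.card) :
    ∃ (a : ℕ) (ν : Multiset ℕ), PartReplacement s F f g l a ν ∧ 1 ≤ a ∧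
      (∀ x ∈ ν, s + 1 ≤ x ∧ x ≤ L + s ∧ x ∉ V) ∧ a * s + ν.sum = N := by
  have hsmall : ∀ x, s + 1 ≤ x → x ≤ 2 * s + 1 → s + 1 ≤ x ∧ x ≤ L + s ∧ x ∉ V := by
    intro x hx hx'
    obtain ⟨k, hk⟩ := hVne
    have := hV k hk
    exact ⟨hx, by omega, fun hxV => by have := hV x hxV; omega⟩
  by_cases hx0 : l.filter (· ∈ V) = 0
  · have hav : ∀ x ∈ l, s + 1 ≤ x ∧ x ≤ L + s ∧ x ∉ V := fun x hx =>
      ⟨(hl x hx).1, (hl x hx).2, fun hxV => Multiset.filter_eq_nil.1 hx0 x hx hxV⟩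
    by_cases hfreq : ∃ i < F, 12 * s ≤ l.count i
    · obtain ⟨i, hiF, hi⟩ := hfreq
      obtain ⟨μ, rfl⟩ := Multiset.le_iff_exists_add.1 (Multiset.le_count_iff_replicate_le.1 hi)
      have hil : i ∈ Multiset.replicate (12 * s) i + μ :=
        Multiset.mem_add.2 (Or.inl (Multiset.mem_replicate.2 ⟨by omega, rfl⟩))
      have his := (hl i hil).1
      refine ⟨12 * i, μ, ?_, by omega, fun x hx => hav x (Multiset.mem_add.2 (Or.inr hx)), ?_⟩
      · rw [add_comm]
        exact .frequentPart i μ his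
      · rw [← hsum, Multiset.sum_add, Multiset.sum_replicate, smul_eq_mul]
        ring
    · push Not at hfreq
      obtain ⟨p, hpl, hpF⟩ : ∃ p ∈ l, F ≤ p := by
        by_contra! hlt
        have := Multiset.sum_le_mul_sum_Icc (s := s) (F := F) (c := 12 * s - 1) (μ := l)
          (fun x hx => ⟨(hl x hx).1, hlt x hx⟩)
          (fun x hx => by have := hfreq x (hlt x hx); omega)
        omega
      obtain ⟨r, a, d, hr, hrs, ha, hd, hp⟩ := exists_large_part_decomposition hs (hF ▸ hpF)
      obtain ⟨hgm, hgs⟩ := hg d hd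
      obtain ⟨μ, rfl⟩ := Multiset.exists_cons_of_mem hpl
      have hsF : 2 * s + 1 < F := by
        have : 1 ≤ (10 * s - 2) * (15 * s - 3) := Nat.mul_pos (by omega) (by omega)
        omega
      refine ⟨a, μ + (12 * s) • g d + {s + r}, ?_, ?_, ?_, ?_⟩
      · have h := PartReplacement.largePart (f := f) (g := g) (F := F) r a μ (g d) hr hrs ha
          (fun x hx => (hgm x hx).2.trans_lt hsF)
          (fun i hi => (Multiset.count_le_count_cons i p μ).trans_lt (hfreq i hi))
        rw [hgs, ← hp] at h
        rwa [← Multiset.singleton_add, add_comm]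
      · rcases ha with ha | ⟨j, hj, _, ha⟩ <;> omega
      · intro x hx
        rcases Multiset.mem_add.1 hx with hx | hx
        · rcases Multiset.mem_add.1 hx with hx | hx
          · exact hav x (Multiset.mem_cons_of_mem hx)
          · have := hgm x (Multiset.mem_of_mem_nsmul hx)
            exact hsmall x this.1 this.2
        · rw [Multiset.mem_singleton.1 hx]
          exact hsmall _ (by omega) (by omega)
      · rw [Multiset.sum_add, Multiset.sum_add, Multiset.sum_nsmul, hgs, Multiset.sum_singleton,
          ← hsum, Multiset.sum_cons, hp, smul_eq_mul]
        ring
  · have hsplit := Multiset.filter_add_not (· ∈ V) l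
    have hx : l.filter (· ∈ V) ≠ 0 ∧ (∀ k ∈ l.filter (· ∈ V), k ∈ V) ∧
        ∀ k ∈ V, ∃ m : ℕ, (l.filter (· ∈ V)).count k = m ^ V.card := by
      refine ⟨hx0, fun k hk => (Multiset.mem_filter.1 hk).2, fun k hk => ?_⟩
      rw [Multiset.count_filter_of_pos hk]
      exact hlV k hk
    obtain ⟨h13, hle⟩ := hf ⟨_, hx⟩
    have hrep := PartReplacement.forbiddenPart (s := s) (F := F) (f := f) (g := g) ⟨_, hx⟩
      (l.filter fun x => ¬ x ∈ V)
    simp only at hrep hle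
    rw [hsplit] at hrep
    have hlsum := congrArg Multiset.sum hsplit
    rw [Multiset.sum_add, hsum] at hlsum
    obtain ⟨hgm, hgs⟩ := hg ((l.filter (· ∈ V)).sum - f ⟨_, hx⟩ * s) (by omega)
    refine ⟨_, _, hrep, by omega, ?_, ?_⟩
    · intro y hy
      rcases Multiset.mem_add.1 hy with hy | hy
      · obtain ⟨hyl, hyV⟩ := Multiset.mem_filter.1 hy
        exact ⟨(hl y hyl).1, (hl y hyl).2, hyV⟩
      · exact hsmall y (hgm y hy).1 (hgm y hy).2
    · rw [Multiset.sum_add, hgs]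
      omega


/-- Let `L ≥ 3` and `s` be positive integers, and
`V = {k_1 > k_2 > ⋯ > k_t} ⊆ {s+1, …, L+s}` nonempty with `t = |V|`, where the least
element `k_t` of `V` satisfies `t! · k_t ≥ (2^{t+4}·s + s²)·t^t`. With
`F(s) = (10s-2)(15s-3) + 8s` and `κ(s) = (12s-1)·((s+1) + ⋯ + (F(s)-1)) + 1`, for
every `N ≥ κ(s)` the number of partitions of `N` in `I_{L,s,V}` is at least the
number of partitions of `N` in `D_{L,s,V}`. -/
theorem impermissible_set_large_min_element (L s : ℕ) (hL : 3 ≤ L) (hs : 0 < s)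
    (V : Finset ℕ) (hV : V ⊆ Finset.Icc (s + 1) (L + s)) (hVne : V.Nonempty)
    (t : ℕ) (ht : t = V.card)
    (hkt : (2 ^ (t + 4) * s + s ^ 2) * t ^ t ≤ Nat.factorial t * V.min' hVne)
    (F κ : ℕ) (hF : F = (10 * s - 2) * (15 * s - 3) + 8 * s)
    (hκ : κ = (12 * s - 1) * (∑ i ∈ Finset.Icc (s + 1) (F - 1), i) + 1)
    (N : ℕ) (hN : κ ≤ N) :
    Nat.card {p : N.Partition //
        p.parts ≠ 0 ∧ (∀ x ∈ p.parts, s + 1 ≤ x ∧ x ≤ L + s) ∧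
          ∀ k ∈ V, ∃ m : ℕ, p.parts.count k = m ^ t} ≤
    Nat.card {p : N.Partition //
        s ∈ p.parts ∧ (∀ x ∈ p.parts, s ≤ x ∧ x ≤ L + s) ∧ ∀ x ∈ p.parts, x ∉ V} := by
  subst ht hF hκ
  have hmin : 2 ^ (V.card + 4) * s ≤ V.min' hVne := by
    have h1 : (2 ^ (V.card + 4) * s + s ^ 2) * V.card ^ V.card ≤
        V.min' hVne * V.card ^ V.card := by
      rw [mul_comm (V.min' hVne)]
      exact hkt.trans (Nat.mul_le_mul_right _ (Nat.factorial_le_pow V.card))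
    have h2 := Nat.le_of_mul_le_mul_right h1 (Nat.pow_pos (Finset.card_pos.2 hVne))
    exact (Nat.le_add_right _ _).trans h2
  have hk : ∀ k ∈ V, 2 ^ (V.card + 4) * s ≤ k := fun k hk => hmin.trans (V.min'_le k hk)
  have hV' : ∀ k ∈ V, 2 * s + 1 < k ∧ k ≤ L + s := by
    intro k hkV
    have h1 := hk k hkV
    have h2 : 2 ^ 4 ≤ 2 ^ (V.card + 4) := Nat.pow_le_pow_right (by norm_num) (by omega)
    have h3 : 2 ^ 4 * s ≤ 2 ^ (V.card + 4) * s := Nat.mul_le_mul_right _ h2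
    exact ⟨by omega, (Finset.mem_Icc.1 (hV hkV)).2⟩
  obtain ⟨f, hf, hfs⟩ := exists_injective_label V hVne s hs hk
  choose! g hg using fun d (hd : s < d) => exists_multiset_sum_eq_of_lt s d hd
  choose a ν hrep ha hν hsum using fun p : {p : N.Partition //
        p.parts ≠ 0 ∧ (∀ x ∈ p.parts, s + 1 ≤ x ∧ x ≤ L + s) ∧
          ∀ k ∈ V, ∃ m : ℕ, p.parts.count k = m ^ V.card} =>
    exists_partReplacement hs hV' hVne rfl hN f hfs g hg p.1.parts p.1.parts_sum p.2.2.1 p.2.2.2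
  have hmem : ∀ p, ∀ x ∈ Multiset.replicate (a p) s + ν p, s ≤ x ∧ x ≤ L + s ∧ x ∉ V := by
    intro p x hx
    rcases Multiset.mem_add.1 hx with hx | hx
    · rw [Multiset.eq_of_mem_replicate hx]
      exact ⟨le_rfl, by omega, fun h => by have := hV' s h; omega⟩
    · obtain ⟨h1, h2, h3⟩ := hν p x hx
      exact ⟨by omega, h2, h3⟩
  refine Nat.card_le_card_of_injective (fun p => ⟨⟨Multiset.replicate (a p) s + ν p,
    fun {x} hx => hs.trans_le (hmem p x hx).1, ?_⟩, ?_, fun x hx => ⟨(hmem p x hx).1,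
      (hmem p x hx).2.1⟩, fun x hx => (hmem p x hx).2.2⟩) ?_
  · rw [Multiset.sum_add, Multiset.sum_replicate, smul_eq_mul, hsum p]
  · exact Multiset.mem_add.2 (Or.inl (Multiset.mem_replicate.2 ⟨by have := ha p; omega, rfl⟩))
  · intro p q hpq
    have hparts : Multiset.replicate (a p) s + ν p = Multiset.replicate (a q) s + ν q :=
      congrArg (fun z => z.1.parts) hpq
    have hcount : ∀ p, (ν p).count s = 0 := fun p =>
      Multiset.count_eq_zero_of_notMem fun h => by have := hν p s h; omega
    have hapq : a p = a q := by
      have h := congrArg (Multiset.count s) hparts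
      simpa [hcount] using h
    rw [hapq] at hparts
    have hνpq : ν p = ν q := add_left_cancel hparts
    have h1 := hrep p
    rw [hapq, hνpq] at h1
    exact Subtype.ext (Nat.Partition.ext (h1.left_unique hf (fun x => (hfs x).1) (hrep q)))
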